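/- Let G be a finite abelian group such that there is no odd prime p for which ℤ_p × ℤ_p is isomorphic to a subgroup of G. Then for all positive integers m ≤ |G| and h, ρ±(G, m, h) = ρ(G, m, h). -/

import Mathlib

open Finset Pointwise

/-- The `h`-fold sumset of a finite subset `A` of an abelian group:
`hA = {Σ λ_a • a : λ : A → ℕ, Σ λ_a = h}`. -/
def foldSumset {G : Type*} [AddCommGroup G] (h : ℕ) (A : Finset G) : Set G :=
  {g | ∃ c : G → ℕ, (∑ a ∈ A, c a) = h ∧ (∑ a ∈ A, c a • a) = g}

/-- The `h`-fold signed sumset of a finite subset `A` of an abelian group: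
`h±A = {Σ λ_a • a : λ : A → ℤ, Σ |λ_a| = h}`. -/
def foldSignedSumset {G : Type*} [AddCommGroup G] (h : ℕ) (A : Finset G) : Set G :=
  {g | ∃ c : G → ℤ, (∑ a ∈ A, (c a).natAbs) = h ∧ (∑ a ∈ A, c a • a) = g}

/-- `ρ(G, m, h) = min {|hA| : A ⊆ G, |A| = m}`. -/
noncomputable def rho (G : Type*) [AddCommGroup G] (m h : ℕ) : ℕ :=
  sInf {k | ∃ A : Finset G, A.card = m ∧ (foldSumset h A).ncard = k}

/-- `ρ±(G, m, h) = min {|h±A| : A ⊆ G, |A| = m}`. -/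
noncomputable def rhoPM (G : Type*) [AddCommGroup G] (m h : ℕ) : ℕ :=
  sInf {k | ∃ A : Finset G, A.card = m ∧ (foldSignedSumset h A).ncard = k}

/-- `f_d(m, h) = (h⌈m/d⌉ - h + 1) d`. -/
def fdmh (d m h : ℕ) : ℕ := (h * ((m + d - 1) / d) - h + 1) * d

/-- `u(n, m, h) = min {f_d(m, h) : d a positive divisor of n}`. -/
noncomputable def uFun (n m h : ℕ) : ℕ :=
  sInf {k | ∃ d : ℕ, 0 < d ∧ d ∣ n ∧ k = fdmh d m h}

section Kneser

variable {G : Type*} [AddCommGroup G]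

/-- The number of elements of a subgroup lying in a set invariant under a smaller subgroup is
either zero or at least the size of the smaller subgroup. -/
theorem card_le_card_filter_of_invariant [Fintype G] (K H : AddSubgroup G) [DecidablePred (· ∈ H)]
    (hKH : K ≤ H) (P : G → Prop) [DecidablePred P] (hP : ∀ k ∈ K, ∀ g, P g → P (k + g))
    {g : G} (hg : g ∈ H) (hPg : P g) :
    Nat.card K ≤ (univ.filter fun x => x ∈ H ∧ P x).card := by
  classical
  rw [← SetLike.coe_sort_coe, Nat.card_coe_set_eq, Set.ncard_eq_toFinset_card']
  refine Finset.card_le_card_of_injOn (fun x => x + g) ?_ ?_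
  · intro x hx
    have hx : x ∈ K := by simpa using hx
    simpa using ⟨H.add_mem (hKH hx) hg, hP x hx g hPg⟩
  · intro x _ y _ hxy
    simpa using hxy

theorem card_filter_add_card_filter_not [Fintype G] (H : AddSubgroup G) [DecidablePred (· ∈ H)]
    (P : G → Prop) [DecidablePred P] :
    (univ.filter fun x => x ∈ H ∧ P x).card + (univ.filter fun x => x ∈ H ∧ ¬ P x).card
      = Nat.card H := by
  rw [← Finset.filter_filter, ← Finset.filter_filter, Finset.card_filter_add_card_filter_not,
    Nat.card_eq_fintype_card, Fintype.card_subtype]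

variable [DecidableEq G]

theorem card_mul_card_le_card_add_mul_card_inf [Fintype G] (H K : AddSubgroup G) (S T : Finset G)
    (hS : ∀ s ∈ S, s ∈ H) (hT : ∀ t ∈ T, t ∈ K) :
    S.card * T.card ≤ (S + T).card * Nat.card ↥(H ⊓ K) := by
  rw [← Finset.card_product, mul_comm, ← Finset.image_add_product]
  refine Finset.card_le_mul_card_image (f := fun x : G × G => x.1 + x.2) _ _ fun g _ => ?_
  rcases ((S ×ˢ T).filter fun x => x.1 + x.2 = g).eq_empty_or_nonempty with h0 | ⟨⟨s₀, t₀⟩, h0⟩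
  · simp [h0]
  simp only [mem_filter, mem_product] at h0
  classical
  rw [← SetLike.coe_sort_coe, Nat.card_coe_set_eq, Set.ncard_eq_toFinset_card']
  refine Finset.card_le_card_of_injOn (fun x => x.1 - s₀) ?_ ?_
  · rintro ⟨s, t⟩ hx
    simp only [mem_coe, mem_filter, mem_product] at hx
    simp only [Set.coe_toFinset, SetLike.mem_coe, AddSubgroup.mem_inf]
    refine ⟨H.sub_mem (hS _ hx.1.1) (hS _ h0.1.1), ?_⟩
    have : s - s₀ = t₀ - t := by
      rw [sub_eq_sub_iff_add_eq_add, hx.2, add_comm, h0.2]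
    rw [this]
    exact K.sub_mem (hT _ h0.1.2) (hT _ hx.1.2)
  · rintro ⟨s, t⟩ hx ⟨s', t'⟩ hx' hxx
    simp only [mem_coe, mem_filter, mem_product] at hx hx'
    have h1 : s = s' := by simpa using hxx
    subst h1
    have h2 : t = t' := add_left_cancel (hx.2.trans hx'.2.symm)
    rw [h2]

theorem card_sdiff_bound_of_mem_sdiff [Fintype G] (H₁ H₂ : AddSubgroup G) (C₁ C₂ : Finset G)
    (hC₁ : ∀ h ∈ H₁, ∀ c ∈ C₁, h + c ∈ C₁) (hC₂ : ∀ h ∈ H₂, ∀ c ∈ C₂, h + c ∈ C₂)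
    {x : G} (hx₁ : x ∈ C₁) (hx₂ : x ∉ C₂) :
    Nat.card H₂ ≤ (C₁ \ C₂).card + Nat.card ↥(H₁ ⊓ H₂) ∨
    Nat.card H₁ ≤ (C₂ \ C₁).card + Nat.card ↥(H₁ ⊓ H₂) ∨
    Nat.card H₁ ≤ (C₁ \ C₂).card := by
  classical
  have hC₁' : ∀ h ∈ H₁, ∀ c, h + c ∈ C₁ ↔ c ∈ C₁ := fun h hh c =>
    ⟨fun hc => by simpa using hC₁ (-h) (H₁.neg_mem hh) _ hc, hC₁ h hh c⟩
  have hC₂' : ∀ h ∈ H₂, ∀ c, h + c ∈ C₂ ↔ c ∈ C₂ := fun h hh c =>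
    ⟨fun hc => by simpa using hC₂ (-h) (H₂.neg_mem hh) _ hc, hC₂ h hh c⟩
  set k := Nat.card ↥(H₁ ⊓ H₂) with hk
  have hkpos : 0 < k := Nat.card_pos
  set T := univ.filter fun h => h ∈ H₂ ∧ h + x ∈ C₁ with hT
  set T' := univ.filter fun h => h ∈ H₂ ∧ ¬ h + x ∈ C₁ with hT'
  set S := univ.filter fun h => h ∈ H₁ ∧ ¬ h + x ∈ C₂ with hS
  set S' := univ.filter fun h => h ∈ H₁ ∧ h + x ∈ C₂ with hS'
  have eT : T.card + T'.card = Nat.card H₂ := card_filter_add_card_filter_not H₂ _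
  have eS : S'.card + S.card = Nat.card H₁ := card_filter_add_card_filter_not H₁ _
  have kT : k ≤ T.card := by
    refine card_le_card_filter_of_invariant (H₁ ⊓ H₂) H₂ inf_le_right (fun h => h + x ∈ C₁) ?_
      H₂.zero_mem (by simpa)
    intro l hl g hg
    rw [add_assoc]
    exact hC₁ l hl.1 _ hg
  have kS : k ≤ S.card := by
    refine card_le_card_filter_of_invariant (H₁ ⊓ H₂) H₁ inf_le_left (fun h => ¬ h + x ∈ C₂) ?_
      H₁.zero_mem (by simpa)
    intro l hl g hg
    rwa [add_assoc, hC₂' l hl.2]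
  have kT' : T'.card = 0 ∨ k ≤ T'.card := by
    rcases T'.eq_empty_or_nonempty with h0 | ⟨g, hg⟩
    · simp [h0]
    right
    simp only [hT', mem_filter, mem_univ, true_and] at hg
    refine card_le_card_filter_of_invariant (H₁ ⊓ H₂) H₂ inf_le_right (fun h => ¬ h + x ∈ C₁) ?_
      hg.1 hg.2
    intro l hl g hg
    rwa [add_assoc, hC₁' l hl.1]
  have kS' : S'.card = 0 ∨ k ≤ S'.card := by
    rcases S'.eq_empty_or_nonempty with h0 | ⟨g, hg⟩
    · simp [h0]
    right
    simp only [hS', mem_filter, mem_univ, true_and] at hg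
    refine card_le_card_filter_of_invariant (H₁ ⊓ H₂) H₁ inf_le_left (fun h => h + x ∈ C₂) ?_
      hg.1 hg.2
    intro l hl g hg
    rw [add_assoc]
    exact hC₂ l hl.2 _ hg
  have hD : S.card * T.card ≤ (C₁ \ C₂).card * k := by
    refine (card_mul_card_le_card_add_mul_card_inf H₁ H₂ S T (fun s hs => ?_) fun t ht => ?_).trans
      (Nat.mul_le_mul_right _ (Finset.card_le_card_of_injOn (fun y => y + x) ?_ ?_))
    · exact (mem_filter.1 hs).2.1
    · exact (mem_filter.1 ht).2.1
    · intro y hy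
      obtain ⟨s, hs, t, ht, rfl⟩ := mem_add.1 (mem_coe.1 hy)
      have hs := (mem_filter.1 hs).2
      have ht := (mem_filter.1 ht).2
      refine mem_coe.2 (mem_sdiff.2 ⟨?_, ?_⟩) <;> beta_reduce
      · rw [add_assoc]
        exact hC₁ s hs.1 _ ht.2
      · rw [add_comm s t, add_assoc, hC₂' t ht.1]
        exact hs.2
    · intro y _ z _ hyz
      simpa using hyz
  have hE : S'.card * T'.card ≤ (C₂ \ C₁).card * k := by
    refine (card_mul_card_le_card_add_mul_card_inf H₁ H₂ S' T' (fun s hs => ?_) fun t ht => ?_).trans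
      (Nat.mul_le_mul_right _ (Finset.card_le_card_of_injOn (fun y => y + x) ?_ ?_))
    · exact (mem_filter.1 hs).2.1
    · exact (mem_filter.1 ht).2.1
    · intro y hy
      obtain ⟨s, hs, t, ht, rfl⟩ := mem_add.1 (mem_coe.1 hy)
      have hs := (mem_filter.1 hs).2
      have ht := (mem_filter.1 ht).2
      refine mem_coe.2 (mem_sdiff.2 ⟨?_, ?_⟩) <;> beta_reduce
      · rw [add_comm s t, add_assoc]
        exact hC₂ t ht.1 _ hs.2
      · rw [add_assoc, hC₁' s hs.1]
        exact ht.2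
    · intro y _ z _ hyz
      simpa using hyz
  rw [← eT, ← eS]
  clear_value k T T' S S'
  clear hT hT' hS hS'
  generalize T.card = α at *
  generalize T'.card = α' at *
  generalize S.card = β at *
  generalize S'.card = β' at *
  generalize (C₁ \ C₂).card = D at *
  generalize (C₂ \ C₁).card = E at *
  rcases kT' with rfl | kT'
  · left
    have : α * k ≤ D * k := le_trans (by nlinarith) hD
    have := Nat.le_of_mul_le_mul_right this hkpos
    omega
  rcases kS' with rfl | kS'
  · right; right
    have : β * k ≤ D * k := le_trans (by nlinarith) hD
    have := Nat.le_of_mul_le_mul_right this hkpos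
    omega
  by_contra! hcon
  obtain ⟨h1, h2, -⟩ := hcon
  obtain ⟨a, rfl⟩ := Nat.exists_eq_add_of_le kT
  obtain ⟨a', rfl⟩ := Nat.exists_eq_add_of_le kT'
  obtain ⟨b, rfl⟩ := Nat.exists_eq_add_of_le kS
  obtain ⟨b', rfl⟩ := Nat.exists_eq_add_of_le kS'
  have hlt : b < a' := by
    by_contra! h
    have : (D + 1) * k ≤ (k + b) * (k + a) := by nlinarith
    nlinarith
  have hlt' : a' < b := by
    by_contra! h
    have : (E + 1) * k ≤ (k + b') * (k + a') := by nlinarith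
    nlinarith
  omega

/-- There is a subgroup `H` stabilising `C` with `n ≤ |C| + |H|`. -/
def AlmostAtLeast (n : ℕ) (C : Finset G) : Prop :=
  ∃ H : AddSubgroup G, (∀ h ∈ H, ∀ c ∈ C, h + c ∈ C) ∧ n ≤ C.card + Nat.card H

theorem AlmostAtLeast.union [Fintype G] {n : ℕ} {C₁ C₂ : Finset G} (h₁ : AlmostAtLeast n C₁)
    (h₂ : AlmostAtLeast n C₂) : AlmostAtLeast n (C₁ ∪ C₂) := by
  by_cases h12 : C₁ ⊆ C₂
  · rwa [union_eq_right.2 h12]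
  by_cases h21 : C₂ ⊆ C₁
  · rwa [union_eq_left.2 h21]
  obtain ⟨H₁, hC₁, hn₁⟩ := h₁
  obtain ⟨H₂, hC₂, hn₂⟩ := h₂
  obtain ⟨x, hx₁, hx₂⟩ := not_subset.1 h12
  obtain ⟨y, hy₂, hy₁⟩ := not_subset.1 h21
  refine ⟨H₁ ⊓ H₂, fun h hh c hc => ?_, ?_⟩
  · rcases mem_union.1 hc with hc | hc
    · exact mem_union_left _ (hC₁ h hh.1 c hc)
    · exact mem_union_right _ (hC₂ h hh.2 c hc)
  have b₁ := card_sdiff_bound_of_mem_sdiff H₁ H₂ C₁ C₂ hC₁ hC₂ hx₁ hx₂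
  have b₂ := card_sdiff_bound_of_mem_sdiff H₂ H₁ C₂ C₁ hC₂ hC₁ hy₂ hy₁
  rw [inf_comm H₂ H₁] at b₂
  have e₁ := Finset.card_sdiff_add_card C₁ C₂
  have e₂ := Finset.card_sdiff_add_card C₂ C₁
  rw [union_comm C₂ C₁] at e₂
  omega

theorem exists_almostAtLeast_subset_add [Fintype G] (N : ℕ) (A B : Finset G) (hN : B.card = N)
    {a b : G} (ha : a ∈ A) (hb : b ∈ B) :
    ∃ C ⊆ A + B, a + b ∈ C ∧ AlmostAtLeast (A.card + B.card) C := by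
  induction N using Nat.strong_induction_on generalizing A B with
  | _ N ih =>
  by_cases hall : ∀ x ∈ A, ∀ y ∈ B, y + (x - b) ∈ A
  · refine ⟨A + B, Subset.rfl, add_mem_add ha hb, AddSubgroup.closure (B.image (· - b)), ?_, ?_⟩
    · intro h hh
      induction hh using AddSubgroup.closure_induction with
      | mem g hg =>
        intro c hc
        obtain ⟨y, hy, rfl⟩ := mem_image.1 (mem_coe.1 hg)
        obtain ⟨x, hx, z, hz, rfl⟩ := mem_add.1 hc
        refine mem_add.2 ⟨_, hall x hx y hy, z, hz, by abel⟩
      | zero => simp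
      | add g g' _ _ hg hg' =>
        intro c hc
        rw [add_assoc]
        exact hg _ (hg' _ hc)
      | neg g _ hg =>
        have himg : (A + B).image (g + ·) = A + B :=
          Finset.eq_of_subset_of_card_le (image_subset_iff.2 hg)
            (by rw [Finset.card_image_of_injective _ (add_right_injective g)])
        intro c hc
        rw [← himg] at hc
        obtain ⟨c', hc', rfl⟩ := mem_image.1 hc
        simpa using hc'
    · refine add_le_add (Finset.card_le_card_add_right ⟨b, hb⟩) ?_
      rw [← SetLike.coe_sort_coe, Nat.card_coe_set_eq,
        ← Finset.card_image_of_injective B (sub_left_injective (b := b)), ← Set.ncard_coe_finset]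
      exact Set.ncard_le_ncard AddSubgroup.subset_closure (Set.toFinite _)
  · push Not at hall
    obtain ⟨x, hx, y, hy, hxy⟩ := hall
    set B' := B.filter fun z => z + (x - b) ∈ A with hB'
    set A' := A ∪ (B.image (· + (x - b))) with hA'
    have hlt : B'.card < N := by
      rw [← hN]
      exact Finset.card_lt_card (filter_ssubset.2 ⟨y, hy, hxy⟩)
    have hsub : A' + B' ⊆ A + B := by
      intro g hg
      obtain ⟨s, hs, t, ht, rfl⟩ := mem_add.1 hg
      obtain ⟨htB, htA⟩ := mem_filter.1 ht
      rcases mem_union.1 hs with hs | hs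
      · exact add_mem_add hs htB
      · obtain ⟨z, hz, rfl⟩ := mem_image.1 hs
        exact mem_add.2 ⟨_, htA, z, hz, by abel⟩
    have hcard : A'.card + B'.card = A.card + B.card := by
      have h1 := Finset.card_union_add_card_inter A (B.image (· + (x - b)))
      rw [Finset.card_image_of_injective _ (add_left_injective _)] at h1
      rw [← h1, hA']
      congr 1
      rw [← Finset.card_image_of_injective B' (add_left_injective (x - b))]
      congr 1
      ext g
      simp only [hB', mem_image, mem_filter, mem_inter]
      constructor
      · rintro ⟨z, ⟨hz, hz'⟩, rfl⟩
        exact ⟨hz', z, hz, rfl⟩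
      · rintro ⟨hg, z, hz, rfl⟩
        exact ⟨z, ⟨hz, hg⟩, rfl⟩
    obtain ⟨C, hC, hab, hCn⟩ := ih _ hlt A' B' rfl (mem_union_left _ ha)
      (mem_filter.2 ⟨hb, by simpa⟩)
    exact ⟨C, hC.trans hsub, hab, hcard ▸ hCn⟩

/-- **Kneser's theorem** for finite abelian groups. -/
theorem kneser [Fintype G] {A B : Finset G} (hA : A.Nonempty) (hB : B.Nonempty) :
    ∃ H : AddSubgroup G, (∀ h ∈ H, ∀ c ∈ A + B, h + c ∈ A + B) ∧
      A.card + B.card ≤ (A + B).card + Nat.card H := by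
  have key : ∀ c ∈ A + B, ∃ C ⊆ A + B, c ∈ C ∧ AlmostAtLeast (A.card + B.card) C := by
    intro c hc
    obtain ⟨a, ha, b, hb, rfl⟩ := mem_add.1 hc
    exact exists_almostAtLeast_subset_add _ A B rfl ha hb
  choose! C hCsub hCmem hC using key
  have hunion : (A + B).sup' (hA.add hB) C = A + B := by
    rw [Finset.sup'_eq_sup]
    refine Subset.antisymm (Finset.sup_le hCsub) fun c hc => ?_
    exact (Finset.le_sup (f := C) hc) (hCmem c hc)
  have := Finset.sup'_induction (hA.add hB) C (p := AlmostAtLeast (A.card + B.card))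
    (fun _ h₁ _ h₂ => h₁.union h₂) hC
  rwa [hunion] at this

end Kneser

theorem foldSumset_subset_foldSignedSumset {G : Type*} [AddCommGroup G] (A : Finset G) (h : ℕ) :
    foldSumset h A ⊆ foldSignedSumset h A := by
  rintro g ⟨c, rfl, rfl⟩
  exact ⟨fun a => c a, by simp, by simp⟩

/-- A set invariant under a subgroup has cardinality divisible by the order of the subgroup. -/
theorem card_dvd_card_of_invariant {G : Type*} [AddCommGroup G] (H : AddSubgroup G) (A : Finset G)
    (hA : ∀ h ∈ H, ∀ a ∈ A, h + a ∈ A) : Nat.card H ∣ A.card := by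
  have hpre : ((↑) : G → G ⧸ H) ⁻¹' ((↑) '' (A : Set G)) = A := by
    refine Set.Subset.antisymm (fun x hx => ?_) (Set.subset_preimage_image _ _)
    obtain ⟨a, ha, hax⟩ := hx
    have := hA _ (QuotientAddGroup.eq.1 hax) a ha
    simpa using this
  have hcard := Nat.card_congr
    (QuotientAddGroup.preimageMkEquivAddSubgroupProdSet H ((↑) '' (A : Set G)))
  rw [hpre, Nat.card_prod, Nat.card_coe_set_eq, Set.ncard_coe_finset] at hcard
  exact ⟨_, hcard⟩

section IteratedSumset

variable {G : Type*} [AddCommGroup G] [DecidableEq G]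

/-- The `h`-fold sumset, built one summand at a time. -/
def iterSumset (A : Finset G) : ℕ → Finset G
  | 0 => {0}
  | h + 1 => iterSumset A h + A

theorem iterSumset_one (A : Finset G) : iterSumset A 1 = A := by
  rw [iterSumset, iterSumset, Finset.singleton_zero, zero_add]

theorem iterSumset_nonempty {A : Finset G} (hA : A.Nonempty) (h : ℕ) :
    (iterSumset A h).Nonempty := by
  induction h with
  | zero => simp [iterSumset]
  | succ h ih => exact ih.add hA

theorem iterSumset_add (A : Finset G) (i j : ℕ) :
    iterSumset A (i + j) = iterSumset A i + iterSumset A j := by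
  induction j with
  | zero => rw [iterSumset, Finset.singleton_zero, add_zero, add_zero]
  | succ j ih => rw [← add_assoc, iterSumset, iterSumset, ih, add_assoc]

theorem nsmul_mem_iterSumset {A : Finset G} {a : G} (ha : a ∈ A) (n : ℕ) :
    n • a ∈ iterSumset A n := by
  induction n with
  | zero => simp [iterSumset]
  | succ n ih =>
    rw [succ_nsmul]
    exact add_mem_add ih ha

theorem zsmul_mem_iterSumset_natAbs {A : Finset G} (hA : ∀ a ∈ A, -a ∈ A) {a : G} (ha : a ∈ A)
    (n : ℤ) : n • a ∈ iterSumset A n.natAbs := by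
  rcases Int.natAbs_eq n with h | h
  · rw [h, natCast_zsmul, Int.natAbs_natCast]
    exact nsmul_mem_iterSumset ha _
  · rw [h, neg_zsmul, natCast_zsmul, ← smul_neg, Int.natAbs_neg, Int.natAbs_natCast]
    exact nsmul_mem_iterSumset (hA a ha) _

theorem sum_mem_iterSumset_sum {A : Finset G} (T : Finset G) (x : G → G) (n : G → ℕ)
    (hx : ∀ a ∈ T, x a ∈ iterSumset A (n a)) : ∑ a ∈ T, x a ∈ iterSumset A (∑ a ∈ T, n a) := by
  induction T using Finset.induction_on with
  | empty => simp [iterSumset]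
  | insert a T ha ih =>
    rw [sum_insert ha, sum_insert ha, iterSumset_add]
    exact add_mem_add (hx a (mem_insert_self _ _)) (ih fun b hb => hx b (mem_insert_of_mem hb))

theorem coe_iterSumset (A : Finset G) (h : ℕ) : (iterSumset A h : Set G) = foldSumset h A := by
  apply Set.Subset.antisymm
  · induction h with
    | zero =>
      intro g hg
      have hg : g = 0 := by simpa [iterSumset] using hg
      exact ⟨0, by simp, by simp [hg]⟩
    | succ h ih =>
      intro g hg
      obtain ⟨x, hx, a, ha, rfl⟩ := mem_add.1 (mem_coe.1 hg)
      obtain ⟨c, hc, rfl⟩ := ih hx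
      exact ⟨c + Pi.single a 1, by simp [sum_add_distrib, hc, Pi.single_apply, ha],
        by simp [sum_add_distrib, add_nsmul, Pi.single_apply, ha, ite_smul]⟩
  · rintro g ⟨c, rfl, rfl⟩
    exact sum_mem_iterSumset_sum A _ _ fun a ha => nsmul_mem_iterSumset ha _

theorem foldSignedSumset_subset_iterSumset {A B : Finset G} (hAB : A ⊆ B)
    (hB : ∀ b ∈ B, -b ∈ B) (h : ℕ) : foldSignedSumset h A ⊆ iterSumset B h := by
  rintro g ⟨c, rfl, rfl⟩
  exact sum_mem_iterSumset_sum A _ _ fun a ha => zsmul_mem_iterSumset_natAbs hB (hAB ha) _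

/-- A translation stabilising an iterated sumset stabilises all later ones. -/
theorem add_mem_iterSumset_of_le {A : Finset G} {i j : ℕ} (hij : i ≤ j) {g : G}
    (hg : ∀ c ∈ iterSumset A i, g + c ∈ iterSumset A i) :
    ∀ c ∈ iterSumset A j, g + c ∈ iterSumset A j := by
  obtain ⟨l, rfl⟩ := Nat.exists_eq_add_of_le hij
  rw [iterSumset_add]
  intro c hc
  obtain ⟨x, hx, y, hy, rfl⟩ := mem_add.1 hc
  rw [← add_assoc]
  exact add_mem_add (hg x hx) hy

theorem mul_card_le_card_iterSumset [Fintype G] {A : Finset G} (hA : A.Nonempty) {h : ℕ}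
    (H : AddSubgroup G) (hH : ∀ g, (∀ c ∈ iterSumset A h, g + c ∈ iterSumset A h) → g ∈ H)
    {j : ℕ} (hj : j + 1 ≤ h) :
    (j + 1) * A.card ≤ (iterSumset A (j + 1)).card + j * Nat.card H := by
  induction j with
  | zero => simp [iterSumset_one]
  | succ j ih =>
    have ih := ih (by omega)
    obtain ⟨K, hK, hcard⟩ := kneser (iterSumset_nonempty hA (j + 1)) hA
    have hKH : K ≤ H := fun g hg => hH g (add_mem_iterSumset_of_le hj (hK g hg))
    have hle : Nat.card K ≤ Nat.card H := AddSubgroup.card_le_of_le hKH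
    rw [iterSumset]
    linarith

theorem iterSumset_add_subgroup (A K : Finset G) (hK : K + K = K) (h : ℕ) :
    iterSumset (A + K) (h + 1) = iterSumset A (h + 1) + K := by
  induction h with
  | zero => simp [iterSumset_one]
  | succ h ih =>
    rw [iterSumset, ih, add_add_add_comm, hK]
    rfl

theorem exists_dvd_fdmh_le_card_iterSumset [Fintype G] {A : Finset G} (hA : A.Nonempty) {h : ℕ}
    (hh : 0 < h) :
    ∃ d, 0 < d ∧ d ∣ Fintype.card G ∧ fdmh d A.card h ≤ (iterSumset A h).card := by
  obtain ⟨h, rfl⟩ : ∃ l, h = l + 1 := ⟨h - 1, by omega⟩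
  let H := AddAction.stabilizer G (iterSumset A (h + 1))
  have hmem : ∀ g, g ∈ H ↔ ∀ c ∈ iterSumset A (h + 1), g + c ∈ iterSumset A (h + 1) := fun g =>
    AddAction.mem_stabilizer_finset'
  classical
  let K : Finset G := univ.filter (· ∈ H)
  have hK : ∀ g, g ∈ K ↔ g ∈ H := by simp [K]
  have hKK : K + K = K := by
    refine Subset.antisymm (fun g hg => ?_) fun g hg => ?_
    · obtain ⟨x, hx, y, hy, rfl⟩ := mem_add.1 hg
      exact (hK _).2 (H.add_mem ((hK _).1 hx) ((hK _).1 hy))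
    · exact mem_add.2 ⟨0, (hK _).2 H.zero_mem, g, hg, by simp⟩
  have hsum : iterSumset (A + K) (h + 1) = iterSumset A (h + 1) := by
    rw [iterSumset_add_subgroup A K hKK]
    refine Subset.antisymm (fun g hg => ?_) fun g hg => ?_
    · obtain ⟨x, hx, y, hy, rfl⟩ := mem_add.1 hg
      rw [add_comm x]
      exact (hmem y).1 ((hK y).1 hy) x hx
    · exact mem_add.2 ⟨g, hg, 0, (hK _).2 H.zero_mem, by simp⟩
  have hsub : A ⊆ A + K := fun a ha => mem_add.2 ⟨a, ha, 0, (hK _).2 H.zero_mem, by simp⟩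
  have hbound := mul_card_le_card_iterSumset (A := A + K) (hA.mono hsub) (h := h + 1) H
    (by rw [hsum]; exact fun g hg => (hmem g).2 hg) le_rfl
  rw [hsum] at hbound
  have hdpos : 0 < Nat.card H := Nat.card_pos
  obtain ⟨r, hr⟩ := card_dvd_card_of_invariant H (A + K) (by
    intro g hg c hc
    obtain ⟨x, hx, y, hy, rfl⟩ := mem_add.1 hc
    exact mem_add.2 ⟨x, hx, g + y, (hK _).2 (H.add_mem hg ((hK _).1 hy)), by abel⟩)
  refine ⟨Nat.card H, hdpos, ?_, ?_⟩
  · rw [← Nat.card_eq_fintype_card]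
    exact AddSubgroup.card_addSubgroup_dvd_card H
  · generalize Nat.card H = d at *
    have hm : A.card ≤ d * r := hr ▸ Finset.card_le_card hsub
    have hceil : (A.card + d - 1) / d ≤ r := by
      rw [Nat.div_le_iff_le_mul_add_pred hdpos]
      omega
    have hr1 : 1 ≤ r := by
      have := hA.card_pos
      by_contra! h0
      have : r = 0 := by omega
      subst this
      omega
    unfold fdmh
    refine (Nat.mul_le_mul_right d (Nat.add_le_add_right
      (Nat.sub_le_sub_right (Nat.mul_le_mul_left _ hceil) _) 1)).trans ?_
    obtain ⟨r, rfl⟩ := Nat.exists_eq_add_of_le' hr1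
    rw [hr] at hbound
    have : (h + 1) * (r + 1) - (h + 1) = (h + 1) * r := by
      rw [mul_add, mul_one, Nat.add_sub_cancel]
    rw [this]
    nlinarith

end IteratedSumset

section Quotients

/-- Two distinct cyclic `p`-power summands give a copy of `ℤ_p × ℤ_p`. -/
theorem exists_injective_pi_zmod {ι : Type*} [DecidableEq ι] (a : ι → ℕ) (ha : ∀ i, a i ≠ 0)
    {p : ℕ} [NeZero p] {i j : ι} (hij : i ≠ j) (hi : p ∣ a i) (hj : p ∣ a j) :
    ∃ f : ZMod p × ZMod p →+ (∀ i, ZMod (a i)), Function.Injective f := by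
  have key : ∀ l, p ∣ a l → ∃ f : ZMod p →+ ZMod (a l), Function.Injective f := by
    intro l hl
    obtain ⟨b, hb⟩ := hl
    have hb0 : b ≠ 0 := by
      rintro rfl
      exact ha l (by simpa using hb)
    refine ⟨ZMod.lift p ⟨zmultiplesHom _ (b : ZMod (a l)), ?_⟩, ?_⟩
    · have : ((p * b : ℕ) : ZMod (a l)) = 0 := by rw [← hb]; simp
      simpa using this
    · rw [ZMod.lift_injective]
      intro m hm
      have hm : ((m * b : ℤ) : ZMod (a l)) = 0 := by simpa using hm
      rw [ZMod.intCast_zmod_eq_zero_iff_dvd, hb] at hm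
      rw [ZMod.intCast_zmod_eq_zero_iff_dvd]
      push_cast at hm
      exact Int.dvd_of_mul_dvd_mul_right (by exact_mod_cast hb0) hm
  obtain ⟨f, hf⟩ := key i hi
  obtain ⟨g, hg⟩ := key j hj
  refine ⟨((AddMonoidHom.single (fun i => ZMod (a i)) i).comp f).coprod
    ((AddMonoidHom.single (fun i => ZMod (a i)) j).comp g), ?_⟩
  rw [injective_iff_map_eq_zero]
  rintro ⟨x, y⟩ hxy
  have h1 : f x = 0 := by simpa [hij] using congrFun hxy i
  have h2 : g y = 0 := by simpa [hij.symm] using congrFun hxy j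
  rw [map_eq_zero_iff f hf] at h1
  rw [map_eq_zero_iff g hg] at h2
  simp [h1, h2]

theorem exists_addEquiv_pi_zmod (G : Type*) [AddCommGroup G] [Finite G] :
    ∃ (ι : Type) (_ : Fintype ι) (p : ι → ℕ) (_ : ∀ i, (p i).Prime) (e : ι → ℕ)
      (_ : G ≃+ (∀ i, ZMod (p i ^ e i))), Nat.card G = ∏ i, p i ^ e i := by
  classical
  obtain ⟨ι, hι, p, hp, e, ⟨F⟩⟩ := AddCommGroup.equiv_directSum_zmod_of_finite G
  have F' := F.trans (DirectSum.addEquivProd fun i => ZMod (p i ^ e i))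
  refine ⟨ι, hι, p, hp, e, F', ?_⟩
  rw [Nat.card_congr F'.toEquiv, Nat.card_pi]
  simp

theorem exists_surjective_zmod_two (G : Type*) [AddCommGroup G] [Finite G] (hG : 2 ∣ Nat.card G) :
    ∃ φ : G →+ ZMod 2, Function.Surjective φ := by
  obtain ⟨ι, _, p, -, e, F, hcard⟩ := exists_addEquiv_pi_zmod G
  rw [hcard, Nat.prime_two.prime.dvd_finsetProd_iff] at hG
  obtain ⟨i, -, hi⟩ := hG
  refine ⟨(ZMod.castHom hi (ZMod 2)).toAddMonoidHom.comp
    ((Pi.evalAddMonoidHom _ i).comp F.toAddMonoidHom), ?_⟩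
  exact (ZMod.castHom_surjective hi).comp ((Function.surjective_eval i).comp F.surjective)

theorem exists_surjective_zmod_of_odd (G : Type*) [AddCommGroup G] [Finite G]
    (hG : ∀ p : ℕ, p.Prime → Odd p → ¬ ∃ f : ZMod p × ZMod p →+ G, Function.Injective f)
    {q : ℕ} (hq : Odd q) (hqG : q ∣ Nat.card G) :
    ∃ φ : G →+ ZMod q, Function.Surjective φ := by
  classical
  obtain ⟨ι, _, p, hp, e, F, hcard⟩ := exists_addEquiv_pi_zmod G
  set a : ι → ℕ := fun i => if Odd (p i) then p i ^ e i else 1 with ha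
  have hdvd : ∀ i, a i ∣ p i ^ e i := by
    intro i
    simp only [ha]
    split_ifs <;> simp
  have hcop : Pairwise (Function.onFun Nat.Coprime a) := by
    intro i j hij
    simp only [Function.onFun, ha]
    split_ifs with hi hj <;> try simp
    rcases eq_or_ne (e i) 0 with hi0 | hi0
    · simp [hi0]
    rcases eq_or_ne (e j) 0 with hj0 | hj0
    · simp [hj0]
    refine Nat.Coprime.pow _ _ ((Nat.coprime_primes (hp i) (hp j)).2 fun hpp => ?_)
    have : NeZero (p i) := ⟨(hp i).ne_zero⟩
    obtain ⟨f, hf⟩ := exists_injective_pi_zmod (fun i => p i ^ e i)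
      (fun i => pow_ne_zero _ (hp i).ne_zero) hij (dvd_pow_self _ hi0)
      (hpp ▸ dvd_pow_self (p j) hj0)
    exact hG (p i) (hp i) hi ⟨F.symm.toAddMonoidHom.comp f, F.symm.injective.comp hf⟩
  have hqa : q ∣ ∏ i, a i := by
    rw [hcard] at hqG
    have hsplit : ∏ i, p i ^ e i = (∏ i, a i) * ∏ i, if Odd (p i) then 1 else p i ^ e i := by
      rw [← prod_mul_distrib]
      refine prod_congr rfl fun i _ => ?_
      simp only [ha]
      split_ifs <;> simp
    rw [hsplit] at hqG
    refine Nat.Coprime.dvd_of_dvd_mul_right (Nat.Coprime.prod_right fun i _ => ?_) hqG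
    split_ifs with hi
    · simp
    · rw [(hp i).eq_two_or_odd'.resolve_right hi]
      exact (Nat.coprime_two_right.2 hq).pow_right _
  refine ⟨(ZMod.castHom hqa (ZMod q)).toAddMonoidHom.comp
    ((ZMod.prodEquivPi a hcop).symm.toAddEquiv.toAddMonoidHom.comp
      ((AddMonoidHom.piMap fun i => (ZMod.castHom (hdvd i) (ZMod (a i))).toAddMonoidHom).comp
        F.toAddMonoidHom)), ?_⟩
  have hpi := Function.Surjective.piMap fun i => ZMod.castHom_surjective (hdvd i)
  exact (ZMod.castHom_surjective hqa).comp ((ZMod.prodEquivPi a hcop).symm.surjective.comp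
    (hpi.comp F.surjective))

/-- All fibres of a surjective homomorphism have the same size. -/
theorem card_preimage_mul_card {G K : Type*} [AddCommGroup G] [AddCommGroup K] [Fintype G]
    [Fintype K] [DecidableEq K] (φ : G →+ K) (hφ : Function.Surjective φ) (B : Finset K) :
    (univ.filter fun g => φ g ∈ B).card * Fintype.card K = B.card * Fintype.card G := by
  have hfib : ∀ y : K, (univ.filter fun g => φ g = y).card = (univ.filter fun g => φ g = 0).card :=
    fun y => AddMonoidHom.card_fiber_eq_of_mem_range φ (hφ y) (hφ 0)
  have hB : ∀ B : Finset K, (univ.filter fun g => φ g ∈ B).card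
      = B.card * (univ.filter fun g => φ g = 0).card := by
    intro B
    rw [Finset.card_eq_sum_card_fiberwise (f := φ) (t := B) (fun g hg => by simpa using hg),
      ← smul_eq_mul, ← Finset.sum_const]
    refine Finset.sum_congr rfl fun y hy => ?_
    rw [← hfib y]
    congr 1
    ext g
    simp only [mem_filter, mem_univ, true_and]
    exact ⟨fun h => h.2, fun h => ⟨h ▸ hy, h⟩⟩
  have huniv := hB univ
  simp only [mem_univ, filter_true, card_univ] at huniv
  rw [hB, huniv]
  ring

end Quotients

section Construction

theorem iterSumset_image {G K : Type*} [AddCommGroup G] [AddCommGroup K] [DecidableEq G]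
    [DecidableEq K] (f : G →+ K) (A : Finset G) (h : ℕ) :
    iterSumset (A.image f) h = (iterSumset A h).image f := by
  induction h with
  | zero => simp [iterSumset]
  | succ h ih => rw [iterSumset, iterSumset, ih, Finset.image_add]

/-- In `ℤ_q` with `q` odd, an arithmetic progression centred at `0` is symmetric. -/
theorem exists_symmetric_progression {q : ℕ} (hq : Odd q) {k : ℕ} (hk : k ≤ q) :
    ∃ B : Finset (ZMod q), (∀ b ∈ B, -b ∈ B) ∧ B.card = k ∧
      ∀ h, 0 < k → (iterSumset B h).card ≤ h * (k - 1) + 1 := by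
  let P : ℕ → ℕ → ZMod q := fun l j => ((2 * j - l : ℤ) : ZMod q)
  refine ⟨(range k).image (P (k - 1)), ?_, ?_, ?_⟩
  · intro b hb
    obtain ⟨j, hj, rfl⟩ := mem_image.1 hb
    have hj := mem_range.1 hj
    refine mem_image.2 ⟨k - 1 - j, mem_range.2 (by omega), ?_⟩
    simp only [P]
    rw [← Int.cast_neg]
    congr 1
    omega
  · rw [Finset.card_image_of_injOn, card_range]
    intro i hi j hj hij
    have hi := mem_range.1 (mem_coe.1 hi)
    have hj := mem_range.1 (mem_coe.1 hj)
    simp only [P] at hij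
    rw [ZMod.intCast_eq_intCast_iff_dvd_sub] at hij
    have h2 : (q : ℤ) ∣ 2 * (j - i) := by
      convert hij using 1
      ring
    have hcop : IsCoprime (q : ℤ) 2 := by
      exact_mod_cast Nat.isCoprime_iff_coprime.2 (Nat.coprime_two_right.2 hq)
    have h3 := Int.eq_zero_of_abs_lt_dvd (hcop.dvd_of_dvd_mul_left h2) (by rw [abs_lt]; omega)
    omega
  · intro h hk0
    have hsub : iterSumset ((range k).image (P (k - 1))) h
        ⊆ (range (h * (k - 1) + 1)).image (P (h * (k - 1))) := by
      induction h with
      | zero => simp [iterSumset, P]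
      | succ h ih =>
        intro g hg
        obtain ⟨x, hx, y, hy, rfl⟩ := mem_add.1 hg
        obtain ⟨i, hi, rfl⟩ := mem_image.1 (ih hx)
        obtain ⟨j, hj, rfl⟩ := mem_image.1 hy
        have hi := mem_range.1 hi
        have hj := mem_range.1 hj
        refine mem_image.2 ⟨i + j, mem_range.2 ?_, ?_⟩
        · rw [Nat.succ_mul]
          omega
        · simp only [P]
          push_cast
          ring
    refine (Finset.card_le_card hsub).trans (Finset.card_image_le.trans ?_)
    rw [card_range]

theorem exists_symmetric_of_odd_quotient {G : Type*} [AddCommGroup G] [Fintype G] [DecidableEq G]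
    (hG : ∀ p : ℕ, p.Prime → Odd p → ¬ ∃ f : ZMod p × ZMod p →+ G, Function.Injective f)
    {d q k : ℕ} (hdq : Fintype.card G = d * q) (hq : Odd q) (hk : k ≤ q) :
    ∃ A : Finset G, (∀ a ∈ A, -a ∈ A) ∧ A.card = k * d ∧
      ∀ h, 0 < k → (iterSumset A h).card ≤ (h * (k - 1) + 1) * d := by
  obtain ⟨φ, hφ⟩ := exists_surjective_zmod_of_odd G hG hq
    (by rw [Nat.card_eq_fintype_card, hdq]; exact dvd_mul_left _ _)
  obtain ⟨B, hBneg, hBcard, hB⟩ := exists_symmetric_progression hq hk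
  have : NeZero q := ⟨hq.pos.ne'⟩
  have hcard : ∀ C : Finset (ZMod q), (univ.filter fun g => φ g ∈ C).card = C.card * d := by
    intro C
    have := card_preimage_mul_card φ hφ C
    rw [ZMod.card, hdq, ← mul_assoc] at this
    exact Nat.eq_of_mul_eq_mul_right hq.pos this
  refine ⟨univ.filter fun g => φ g ∈ B, ?_, by rw [hcard, hBcard], fun h hk0 => ?_⟩
  · intro a ha
    have ha := (mem_filter.1 ha).2
    simpa using hBneg _ ha
  · refine le_trans ?_ (Nat.mul_le_mul_right d (hB h hk0))
    rw [← hcard]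
    refine Finset.card_le_card fun g hg => mem_filter.2 ⟨mem_univ _, ?_⟩
    have hsub : iterSumset ((univ.filter fun g => φ g ∈ B).image φ) h ⊆ iterSumset B h := by
      have himg : (univ.filter fun g => φ g ∈ B).image φ ⊆ B := by
        intro y hy
        obtain ⟨x, hx, rfl⟩ := mem_image.1 hy
        exact (mem_filter.1 hx).2
      generalize h = l
      induction l with
      | zero => exact Subset.rfl
      | succ l ih => exact add_subset_add ih himg
    rw [iterSumset_image] at hsub
    exact hsub (mem_image_of_mem _ hg)

theorem exists_symmetric_set (n : ℕ) :
    ∀ (G : Type*) [AddCommGroup G] [Fintype G] [DecidableEq G], Fintype.card G = n →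
    (∀ p : ℕ, p.Prime → Odd p → ¬ ∃ f : ZMod p × ZMod p →+ G, Function.Injective f) →
    ∀ d k : ℕ, d ∣ n → k * d ≤ n → ∃ A : Finset G, (∀ a ∈ A, -a ∈ A) ∧ A.card = k * d ∧
      ∀ h, 0 < h → 0 < k → (iterSumset A h).card ≤ (h * (k - 1) + 1) * d := by
  induction n using Nat.strong_induction_on with
  | _ n ih =>
  intro G _ _ _ hn hG d k hdn hkd
  obtain ⟨q, hq⟩ := hdn
  have hnpos : 0 < n := hn ▸ Fintype.card_pos
  have hdpos : 0 < d := Nat.pos_of_mul_pos_right (hq ▸ hnpos)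
  rcases Nat.even_or_odd q with hqeven | hqodd
  swap
  · have hkq : k ≤ q := Nat.le_of_mul_le_mul_right (by rwa [mul_comm q, ← hq]) hdpos
    obtain ⟨A, h1, h2, h3⟩ := exists_symmetric_of_odd_quotient hG (hn.trans hq) hqodd hkq
    exact ⟨A, h1, h2, fun h _ => h3 h⟩
  obtain ⟨r, hr⟩ := hqeven
  obtain ⟨φ, hφ⟩ := exists_surjective_zmod_two G
    ⟨d * r, by rw [Nat.card_eq_fintype_card, hn, hq, hr]; ring⟩
  classical
  have hker : Fintype.card φ.ker = d * r := by
    have h1 := card_preimage_mul_card φ hφ {0}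
    rw [ZMod.card, hn, hq, hr, card_singleton] at h1
    have h2 : Fintype.card φ.ker = (univ.filter fun g => φ g ∈ ({0} : Finset (ZMod 2))).card := by
      rw [Fintype.card_subtype]
      congr 1
      ext g
      simp [AddMonoidHom.mem_ker]
    rw [h2]
    linarith
  have hn2 : n = 2 * (d * r) := by rw [hq, hr]; ring
  have hN : ∀ d' k' : ℕ, d' ∣ d * r → k' * d' ≤ d * r → ∃ A : Finset G, (∀ a ∈ A, -a ∈ A) ∧
      A.card = k' * d' ∧
      ∀ h, 0 < h → 0 < k' → (iterSumset A h).card ≤ (h * (k' - 1) + 1) * d' := by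
    intro d' k' hd' hk'
    obtain ⟨A, h1, h2, h3⟩ := ih (d * r) (by omega) φ.ker hker
      (fun p hp hpo ⟨f, hf⟩ => hG p hp hpo
        ⟨φ.ker.subtype.comp f, φ.ker.subtype_injective.comp hf⟩) d' k' hd' hk'
    refine ⟨A.image φ.ker.subtype, ?_, ?_, ?_⟩
    · intro a ha
      obtain ⟨b, hb, rfl⟩ := mem_image.1 ha
      exact mem_image.2 ⟨-b, h1 b hb, map_neg _ _⟩
    · rw [Finset.card_image_of_injective _ φ.ker.subtype_injective, h2]
    · intro h hh hk
      rw [iterSumset_image]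
      exact Finset.card_image_le.trans (h3 h hh hk)
  by_cases hsmall : k * d ≤ d * r
  · exact hN d k (dvd_mul_right _ _) hsmall
  obtain ⟨A, hAneg, hAcard, -⟩ := hN 1 (n - k * d) (one_dvd _) (by omega)
  have hAc : Aᶜ.card = k * d := by
    rw [Finset.card_compl, hAcard, hn]
    omega
  refine ⟨Aᶜ, fun a ha => ?_, hAc, fun h hh hk => ?_⟩
  · rw [mem_compl] at ha ⊢
    exact fun h => ha (by simpa using hAneg _ h)
  · obtain rfl | hh2 : h = 1 ∨ 2 ≤ h := by omega
    · rw [iterSumset_one, hAc, one_mul, Nat.sub_add_cancel hk]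
    · refine (Finset.card_le_univ _).trans ?_
      rw [hn, hn2]
      have hrk : r ≤ k - 1 := by
        by_contra! hlt
        have : k ≤ r := by omega
        exact hsmall (by rw [mul_comm d]; exact Nat.mul_le_mul_right d this)
      have : 2 * r ≤ h * (k - 1) := Nat.mul_le_mul hh2 hrk
      calc 2 * (d * r) = (2 * r) * d := by ring
        _ ≤ _ := Nat.mul_le_mul_right d (by omega)

end Construction

theorem not_exists_injective_of_no_subgroup {G : Type*} [AddCommGroup G]
    (hp : ¬ ∃ p : ℕ, p.Prime ∧ Odd p ∧
      ∃ H : AddSubgroup G, Nonempty (H ≃+ (ZMod p × ZMod p)))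
    (p : ℕ) (hpp : p.Prime) (hpo : Odd p) :
    ¬ ∃ f : ZMod p × ZMod p →+ G, Function.Injective f := by
  rintro ⟨f, hf⟩
  exact hp ⟨p, hpp, hpo, f.range, ⟨(AddMonoidHom.ofInjective hf).symm⟩⟩

/-- if no odd prime `p` has `ℤ_p × ℤ_p` isomorphic to a subgroup of `G`,
then `ρ±(G, m, h) = ρ(G, m, h)`. -/
theorem rhoPM_eq_rho_of_no_odd_p_rank_two (G : Type*) [AddCommGroup G] [Fintype G]
    (hp : ¬ ∃ p : ℕ, p.Prime ∧ Odd p ∧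
      ∃ H : AddSubgroup G, Nonempty (H ≃+ (ZMod p × ZMod p)))
    (m h : ℕ) (hm : 0 < m) (hmn : m ≤ Fintype.card G) (hh : 0 < h) :
    rhoPM G m h = rho G m h := by
  classical
  obtain ⟨A₀, -, hA₀⟩ := Finset.exists_subset_card_eq (s := (univ : Finset G)) (by simpa using hmn)
  apply le_antisymm
  · obtain ⟨A, hAm, hA⟩ := Nat.sInf_mem (s := {k | ∃ A : Finset G, A.card = m ∧
      (foldSumset h A).ncard = k}) ⟨_, A₀, hA₀, rfl⟩
    obtain ⟨d, hd, hdG, hle⟩ := exists_dvd_fdmh_le_card_iterSumset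
      (Finset.card_pos.1 (hAm ▸ hm)) hh
    rw [← Set.ncard_coe_finset (iterSumset A h), coe_iterSumset, hA, hAm] at hle
    refine le_trans ?_ hle
    set k := (m + d - 1) / d with hk
    have hmk : m ≤ k * d := by
      have := Nat.lt_div_mul_add (a := m + d - 1) hd
      rw [← hk] at this
      omega
    have hk0 : 0 < k := Nat.pos_of_mul_pos_right (hm.trans_le hmk)
    have hkG : k * d ≤ Fintype.card G := by
      obtain ⟨q, hq⟩ := hdG
      rw [hq, mul_comm d]
      refine Nat.mul_le_mul_right d ?_
      rw [hk, Nat.div_le_iff_le_mul_add_pred hd]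
      omega
    obtain ⟨B, hBneg, hBcard, hB⟩ := exists_symmetric_set _ G rfl
      (not_exists_injective_of_no_subgroup hp) d k hdG hkG
    obtain ⟨C, hCB, hCm⟩ := Finset.exists_subset_card_eq (hBcard ▸ hmk)
    calc rhoPM G m h ≤ (foldSignedSumset h C).ncard := Nat.sInf_le ⟨C, hCm, rfl⟩
      _ ≤ (iterSumset B h : Set G).ncard :=
        Set.ncard_le_ncard (foldSignedSumset_subset_iterSumset hCB hBneg h) (Set.toFinite _)
      _ ≤ (h * (k - 1) + 1) * d := by
        rw [Set.ncard_coe_finset]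
        exact hB h hh hk0
      _ = fdmh d m h := by rw [fdmh, ← hk, Nat.mul_sub_one]
  · obtain ⟨A, hAm, hA⟩ := Nat.sInf_mem (s := {k | ∃ A : Finset G, A.card = m ∧
      (foldSignedSumset h A).ncard = k}) ⟨_, A₀, hA₀, rfl⟩
    calc rho G m h ≤ (foldSumset h A).ncard := Nat.sInf_le ⟨A, hAm, rfl⟩
      _ ≤ (foldSignedSumset h A).ncard :=
        Set.ncard_le_ncard (foldSumset_subset_foldSignedSumset A h) (Set.toFinite _)
      _ = rhoPM G m h := hA
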